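/- arXiv:1802.03096 — 7 statements merged into one kernel-verified Lean document; each statement's English description precedes it below -/
import Mathlib

section
/- No-passing property for AQS-A orbits: let an AQS-A satisfy the no-passing property with respect to a compatible partial order ⪯. Then for any triplet of distinct states μ, σ, ν with μ ≺ σ ≺ ν: (a) if μ ∈ D*ν then μ ∈ D*σ; and (b) if ν ∈ U*μ then ν ∈ U*σ. -/
/-- An AQS automaton: a set of configurations `S` with trapping fields
`Fm, Fp : S → ℝ ∪ {−∞, +∞}` and maps `U, D : S → S` satisfying the AQS
compatibility conditions.  `U` has the unique fixed point `ω` with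
`Fp ω = +∞` and `D` has the unique fixed point `α` with `Fm α = −∞`. -/
structure AQSA (S : Type*) where
  Fm : S → EReal
  Fp : S → EReal
  U : S → S
  D : S → S
  ω : S
  α : S
  lt_trap : ∀ σ, Fm σ < Fp σ
  Fp_U : ∀ σ, U σ ≠ σ → Fp σ < Fp (U σ)
  Fm_U : ∀ σ, Fm (U σ) < Fp σ
  Fm_D : ∀ σ, D σ ≠ σ → Fm (D σ) < Fm σ
  Fp_D : ∀ σ, Fm σ < Fp (D σ)
  U_fix : U ω = ω
  U_fix_unique : ∀ σ, U σ = σ → σ = ω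
  D_fix : D α = α
  D_fix_unique : ∀ σ, D σ = σ → σ = α
  Fp_omega : Fp ω = ⊤
  Fm_alpha : Fm α = ⊥

namespace AQSA

variable {S : Type*} (A : AQSA S)

/-- `A.inU μ ν` means `ν ∈ U*μ`, i.e. `ν` lies on the `U`-orbit of `μ`. -/
def inU (μ ν : S) : Prop := ∃ k : ℕ, A.U^[k] μ = ν

/-- `A.inD μ ν` means `μ ∈ D*ν`, i.e. `μ` lies on the `D`-orbit of `ν`. -/
def inD (μ ν : S) : Prop := ∃ k : ℕ, A.D^[k] ν = μ

/-- `(μ, ν)` forms a loop: `ν ∈ U*μ` and `μ ∈ D*ν`. -/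
def Loop (μ ν : S) : Prop := A.inU μ ν ∧ A.inD μ ν

/-- The loop return point memory (ℓRPM) property. -/
def lRPM : Prop :=
  (∀ (μ : S) (i j : ℕ), i ≤ j → A.inD μ (A.U^[j] μ) → A.inD μ (A.U^[i] μ)) ∧
  (∀ (ν : S) (i j : ℕ), i ≤ j → A.inU (A.D^[j] ν) ν → A.inU (A.D^[i] ν) ν)

/-- One step of the dynamics: `b = Ua` or `b = Da`. -/
def Step (a b : S) : Prop := b = A.U a ∨ b = A.D a

/-- The set of reachable states: states connected to `α` by some field-history. -/
def Reach : Set S := {σ | Relation.ReflTransGen A.Step A.α σ}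

/-- `σ` is reachable from an endpoint of the loop `(μ,ν)` by a `(μ,ν)`-confined
field-history: a finite sequence starting at `μ` or `ν`, each step is `U` or
`D`, and no intermediate state of the sequence equals `μ` or `ν`. -/
def ReachLoop (μ ν σ : S) : Prop :=
  ∃ (N : ℕ) (f : ℕ → S),
    (f 0 = μ ∨ f 0 = ν) ∧
    (∀ k < N, f (k + 1) = A.U (f k) ∨ f (k + 1) = A.D (f k)) ∧
    (∀ k, 0 < k → k < N → f k ≠ μ ∧ f k ≠ ν) ∧
    f N = σ

/-- `x` is on the `U`-boundary of the loop `(a,b)`. -/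
def onUB (a b x : S) : Prop := A.inU a x ∧ A.inU x b

/-- `x` is on the `D`-boundary of the loop `(a,b)`. -/
def onDB (a b x : S) : Prop := A.inD a x ∧ A.inD x b

/-- `x` is an interior state of the loop `(a,b)`: it is `(a,b)`-reachable and
lies on neither boundary. -/
def Interior (a b x : S) : Prop :=
  A.ReachLoop a b x ∧ ¬ A.onUB a b x ∧ ¬ A.onDB a b x

/-- `y = ψ₋(x)` for the loop with upper endpoint `ν`: `y` is the
`⪯_D`-greatest element of `D*x ∩ D*ν`. -/
def IsPsiM (ν x y : S) : Prop :=
  (A.inD y x ∧ A.inD y ν) ∧ ∀ z, A.inD z x ∧ A.inD z ν → A.inD z y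

/-- `y = ψ₊(x)` for the loop with lower endpoint `μ`: `y` is the
`⪯_U`-least element of `U*x ∩ U*μ`. -/
def IsPsiP (μ x y : S) : Prop :=
  (A.inU x y ∧ A.inU μ y) ∧ ∀ z, A.inU x z ∧ A.inU μ z → A.inU y z

/-- `𝒰[F]σ` : the first state along `σ, Uσ, U²σ, …` whose upper trapping
field exceeds `F`. -/
noncomputable def Uact (F : ℝ) (σ : S) : S := by
  classical
  exact if h : ∃ i : ℕ, (F : EReal) < A.Fp (A.U^[i] σ) then A.U^[Nat.find h] σ else σ

/-- `𝒟[F]σ` : the first state along `σ, Dσ, D²σ, …` whose lower trapping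
field is below `F`. -/
noncomputable def Dact (F : ℝ) (σ : S) : S := by
  classical
  exact if h : ∃ i : ℕ, A.Fm (A.D^[i] σ) < (F : EReal) then A.D^[Nat.find h] σ else σ

/-- A partial order `le` on `S` is compatible with `U` and `D`. -/
def Compatible (le : S → S → Prop) : Prop :=
  (∀ σ, le A.α σ ∧ le σ A.ω) ∧
  (∀ σ, le σ (A.U σ)) ∧ (∀ σ, A.U σ = σ → σ = A.ω) ∧
  (∀ σ, le (A.D σ) σ) ∧ (∀ σ, A.D σ = σ → σ = A.α)

/-- The no-passing property with respect to a compatible partial order `le`. -/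
def NoPassing (le : S → S → Prop) : Prop :=
  ∀ η σ : S, le η σ → ∀ F₁ F₂ : ℝ, F₁ ≤ F₂ →
    le (A.Uact F₁ η) (A.Uact F₂ σ) ∧ le (A.Dact F₁ η) (A.Dact F₂ σ)

/-- `(μ,ν)` is a maximal loop. -/
def MaxLoop (μ ν : S) : Prop :=
  A.Loop μ ν ∧
  (∀ ν', A.inU ν ν' → ν' ≠ ν → ∀ σ, A.inD σ ν' → ¬ A.ReachLoop μ ν σ) ∧
  (∀ μ', A.inD μ' μ → μ' ≠ μ → ∀ σ, A.inU μ' σ → ¬ A.ReachLoop μ ν σ)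

/-- The amplitudes `Fl < Fu` are `(μ,ν)`-traversing. -/
def Traversing (μ ν : S) (Fl Fu : ℝ) : Prop :=
  Fl < Fu ∧ A.Uact Fu μ = ν ∧ A.Dact Fl ν = μ

/-- The loop `(μ,ν)` is marginal. -/
def Marginal (μ ν : S) : Prop :=
  ∀ Fl Fu : ℝ, A.Traversing μ ν Fl Fu →
    ∀ F : ℝ, Fl ≤ F → F ≤ Fu →
      A.Dact Fl (A.Uact F μ) = μ ∧ A.Uact Fu (A.Dact F ν) = ν

/-- The automaton exhibits marginal stability: every loop is marginal. -/
def MarginalStability : Prop := ∀ μ ν : S, A.Loop μ ν → A.Marginal μ ν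

end AQSA

/-- If `g` strictly increases along `f` off the fixed points of `f`, then a point `y ≠ x` of the
`f`-orbit of `x` is reached at a first time, before which `g` stays below some level `g w < g y`. -/
theorem exists_iterate_eq_and_forall_lt_le {S β : Type*} [LinearOrder β] {f : S → S} {g : S → β}
    (hg : ∀ x, f x ≠ x → g x < g (f x)) {x y : S} (hne : y ≠ x) (h : ∃ k : ℕ, f^[k] x = y) :
    ∃ (k : ℕ) (w : S), f^[k] x = y ∧ g w < g y ∧ ∀ i < k, g (f^[i] x) ≤ g w := by
  classical
  have hmono : Monotone fun i : ℕ => g (f^[i] x) := by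
    refine monotone_nat_of_le_succ fun i => ?_
    simp only [Function.iterate_succ_apply']
    by_cases hi : f (f^[i] x) = f^[i] x
    · rw [hi]
    · exact (hg _ hi).le
  obtain ⟨k, hk, hmin⟩ : ∃ k : ℕ, f^[k] x = y ∧ ∀ i < k, f^[i] x ≠ y :=
    ⟨Nat.find h, Nat.find_spec h, fun i hi => Nat.find_min h hi⟩
  obtain _ | k := k
  · exact absurd hk.symm hne
  rw [Function.iterate_succ_apply'] at hk
  refine ⟨k + 1, f^[k] x, by rw [Function.iterate_succ_apply', hk], ?_,
    fun i hi => hmono (Nat.le_of_lt_succ hi)⟩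
  have := hg (f^[k] x) (hk ▸ (hmin k k.lt_succ_self).symm)
  rwa [hk] at this

namespace AQSA

variable {S : Type*} (A : AQSA S)

theorem inU_Uact (F : ℝ) (σ : S) : A.inU σ (A.Uact F σ) := by
  unfold Uact
  split_ifs with h
  · exact ⟨_, rfl⟩
  · exact ⟨0, rfl⟩

theorem inD_Dact (F : ℝ) (σ : S) : A.inD (A.Dact F σ) σ := by
  unfold Dact
  split_ifs with h
  · exact ⟨_, rfl⟩
  · exact ⟨0, rfl⟩

variable {A}

theorem Uact_eq_of_forall_lt {F : ℝ} {σ η : S} {k : ℕ} (hk : A.U^[k] σ = η)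
    (hF : (F : EReal) < A.Fp η) (hlt : ∀ i < k, A.Fp (A.U^[i] σ) ≤ F) : A.Uact F σ = η := by
  classical
  have h : ∃ i : ℕ, (F : EReal) < A.Fp (A.U^[i] σ) := ⟨k, hk ▸ hF⟩
  have hfind : Nat.find h = k :=
    (Nat.find_eq_iff h).2 ⟨hk ▸ hF, fun i hi => (hlt i hi).not_gt⟩
  rw [Uact, dif_pos h, ← hk, ← hfind]

theorem Dact_eq_of_forall_lt {F : ℝ} {σ η : S} {k : ℕ} (hk : A.D^[k] σ = η)
    (hF : A.Fm η < (F : EReal)) (hlt : ∀ i < k, (F : EReal) ≤ A.Fm (A.D^[i] σ)) :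
    A.Dact F σ = η := by
  classical
  have h : ∃ i : ℕ, A.Fm (A.D^[i] σ) < (F : EReal) := ⟨k, hk ▸ hF⟩
  have hfind : Nat.find h = k :=
    (Nat.find_eq_iff h).2 ⟨hk ▸ hF, fun i hi => (hlt i hi).not_gt⟩
  rw [Dact, dif_pos h, ← hk, ← hfind]

/-- A state `ν ≠ μ` of the `U`-orbit of `μ` is reached from `μ` by raising the field to a value at
which `ν` itself is stable. -/
theorem inU.exists_Uact_eq {μ ν : S} (h : A.inU μ ν) (hne : μ ≠ ν) :
    ∃ F : ℝ, A.Uact F μ = ν ∧ A.Uact F ν = ν := by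
  obtain ⟨k, w, hk, hw, hle⟩ := exists_iterate_eq_and_forall_lt_le A.Fp_U hne.symm h
  obtain ⟨F, hwF, hF⟩ := EReal.lt_iff_exists_real_btwn.1 hw
  exact ⟨F, Uact_eq_of_forall_lt hk hF fun i hi => (hle i hi).trans hwF.le,
    Uact_eq_of_forall_lt (k := 0) rfl hF fun i hi => absurd hi i.not_lt_zero⟩

/-- A state `μ ≠ ν` of the `D`-orbit of `ν` is reached from `ν` by lowering the field to a value at
which `μ` itself is stable. -/
theorem inD.exists_Dact_eq {μ ν : S} (h : A.inD μ ν) (hne : μ ≠ ν) :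
    ∃ F : ℝ, A.Dact F ν = μ ∧ A.Dact F μ = μ := by
  obtain ⟨k, w, hk, hw, hle⟩ := exists_iterate_eq_and_forall_lt_le
    (g := fun σ => OrderDual.toDual (A.Fm σ)) (fun σ hσ => A.Fm_D σ hσ) hne h
  obtain ⟨F, hF, hFw⟩ := EReal.lt_iff_exists_real_btwn.1 (OrderDual.toDual_lt_toDual.1 hw)
  exact ⟨F, Dact_eq_of_forall_lt hk hF
      fun i hi => hFw.le.trans (OrderDual.toDual_le_toDual.1 (hle i hi)),
    Dact_eq_of_forall_lt (k := 0) rfl hF fun i hi => absurd hi i.not_lt_zero⟩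

end AQSA

/-- No-passing property for AQS-A orbits. -/
theorem no_passing_orbits {S : Type*} [Fintype S] (A : AQSA S)
    (le : S → S → Prop) (hpo : IsPartialOrder S le) (hc : A.Compatible le)
    (hnp : A.NoPassing le)
    (μ σ ν : S) (hμσne : μ ≠ σ) (hσνne : σ ≠ ν) (hμνne : μ ≠ ν)
    (hμσ : le μ σ) (hσν : le σ ν) :
    (A.inD μ ν → A.inD μ σ) ∧ (A.inU μ ν → A.inU σ ν) := by
  refine ⟨fun h => ?_, fun h => ?_⟩
  · obtain ⟨F, hν, hμ⟩ := h.exists_Dact_eq hμνne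
    have h₁ := (hnp μ σ hμσ F F le_rfl).2
    have h₂ := (hnp σ ν hσν F F le_rfl).2
    rw [hμ] at h₁
    rw [hν] at h₂
    exact hpo.antisymm _ _ h₁ h₂ ▸ A.inD_Dact F σ
  · obtain ⟨F, hμ, hν⟩ := h.exists_Uact_eq hμνne
    have h₁ := (hnp μ σ hμσ F F le_rfl).1
    have h₂ := (hnp σ ν hσν F F le_rfl).1
    rw [hμ] at h₁
    rw [hν] at h₂
    exact hpo.antisymm _ _ h₁ h₂ ▸ A.inU_Uact F σ
end

section
/- Mutual reachability on the set ℛ of reachable states: for any pair of reachable states σ₁, σ₂ ∈ ℛ there exists a field-history (a finite sequence of applications of U and D) mapping σ₁ to σ₂ and a field-history mapping σ₂ to σ₁; moreover ℛ is closed under the actions of U and D. -/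
/-- From every state, repeated application of `D` leads to `α`. -/
theorem AQSA.reflTransGen_step_alpha {S : Type*} [Finite S] (A : AQSA S) (σ : S) :
    Relation.ReflTransGen A.Step σ A.α := by
  have wf : WellFounded (fun a b : S => A.Fm a < A.Fm b) :=
    haveI : IsTrans S (fun a b : S => A.Fm a < A.Fm b) := ⟨fun _ _ _ => lt_trans⟩
    haveI : Std.Irrefl (fun a b : S => A.Fm a < A.Fm b) := ⟨fun _ => lt_irrefl _⟩
    Finite.wellFounded_of_trans_of_irrefl _
  induction σ using wf.induction with
  | _ σ ih =>
    by_cases hσ : A.D σ = σ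
    · rw [A.D_fix_unique σ hσ]
    · exact .head (.inr rfl) (ih (A.D σ) (A.Fm_D σ hσ))

/-- Mutual reachability on the set ℛ of reachable states, and
closure of ℛ under `U` and `D`. -/
theorem mutual_reachability {S : Type*} [Fintype S] (A : AQSA S) :
    (∀ σ₁ ∈ A.Reach, ∀ σ₂ ∈ A.Reach,
      Relation.ReflTransGen A.Step σ₁ σ₂ ∧ Relation.ReflTransGen A.Step σ₂ σ₁) ∧
    (∀ σ ∈ A.Reach, A.U σ ∈ A.Reach ∧ A.D σ ∈ A.Reach) := by
  refine ⟨fun σ₁ h₁ σ₂ h₂ => ⟨?_, ?_⟩, fun σ h => ⟨?_, ?_⟩⟩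
  · exact (A.reflTransGen_step_alpha σ₁).trans h₂
  · exact (A.reflTransGen_step_alpha σ₂).trans h₁
  · exact Relation.ReflTransGen.tail h (.inl rfl)
  · exact Relation.ReflTransGen.tail h (.inr rfl)
end

section
/- Monotonicity of the boundary-to-boundary maps ψ₊ and ψ₋: in an ℓAQS-A, for a loop (μ,ν): (i) ψ₋(μ) = μ, ψ₋(ν) = ν, ψ₊(μ) = μ and ψ₊(ν) = ν; (ii) ψ₋ and ψ₊ are non-decreasing: if ν_i ≺_U ν_j are U-boundary states then ψ₋(ν_i) ⪯_D ψ₋(ν_j), and if μ_i ≺_D μ_j are D-boundary states then ψ₊(μ_i) ⪯_U ψ₊(μ_j). -/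
namespace AQSA

variable {S : Type*} {A : AQSA S}

theorem inU.refl (x : S) : A.inU x x := ⟨0, rfl⟩

theorem inD.refl (x : S) : A.inD x x := ⟨0, rfl⟩

theorem inU.trans {x y z : S} (h : A.inU x y) (h' : A.inU y z) : A.inU x z := by
  obtain ⟨k, rfl⟩ := h
  obtain ⟨l, rfl⟩ := h'
  exact ⟨l + k, Function.iterate_add_apply _ _ _ _⟩

theorem inD.trans {x y z : S} (h : A.inD x y) (h' : A.inD y z) : A.inD x z := by
  obtain ⟨k, rfl⟩ := h
  obtain ⟨l, rfl⟩ := h'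
  exact ⟨k + l, Function.iterate_add_apply _ _ _ _⟩

theorem lRPM.inD_of_inU {μ σ ν : S} (h : A.lRPM) (hμσ : A.inU μ σ) (hσν : A.inU σ ν)
    (hμν : A.inD μ ν) : A.inD μ σ := by
  obtain ⟨i, rfl⟩ := hμσ
  obtain ⟨j, rfl⟩ := hσν
  rw [← Function.iterate_add_apply] at hμν
  exact h.1 μ i (j + i) (Nat.le_add_left i j) hμν

theorem lRPM.inU_of_inD {μ σ ν : S} (h : A.lRPM) (hμσ : A.inD μ σ) (hσν : A.inD σ ν)
    (hμν : A.inU μ ν) : A.inU σ ν := by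
  obtain ⟨i, rfl⟩ := hσν
  obtain ⟨j, rfl⟩ := hμσ
  rw [← Function.iterate_add_apply] at hμν
  exact h.2 ν i (j + i) (Nat.le_add_left i j) hμν

/-- If a forward orbit meets a set, its first element in the set precedes all the others. -/
theorem exists_first_iterate_mem {f : S → S} {x : S} {p : S → Prop} (h : ∃ k : ℕ, p (f^[k] x)) :
    ∃ y, ((∃ k : ℕ, f^[k] x = y) ∧ p y) ∧
      ∀ z, (∃ k : ℕ, f^[k] x = z) ∧ p z → ∃ k : ℕ, f^[k] y = z := by
  classical
  refine ⟨f^[Nat.find h] x, ⟨⟨_, rfl⟩, Nat.find_spec h⟩, ?_⟩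
  rintro _ ⟨⟨m, rfl⟩, hm⟩
  refine ⟨m - Nat.find h, ?_⟩
  rw [← Function.iterate_add_apply, Nat.sub_add_cancel (Nat.find_min' h hm)]

theorem exists_isPsiM {ν x z : S} (hx : A.inD z x) (hν : A.inD z ν) : ∃ y, A.IsPsiM ν x y := by
  obtain ⟨k, rfl⟩ := hx
  exact exists_first_iterate_mem (p := fun y => A.inD y ν) ⟨k, hν⟩

theorem exists_isPsiP {μ x z : S} (hx : A.inU x z) (hμ : A.inU μ z) : ∃ y, A.IsPsiP μ x y := by
  obtain ⟨k, rfl⟩ := hx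
  exact exists_first_iterate_mem (p := fun y => A.inU μ y) ⟨k, hμ⟩

theorem IsPsiM.mono {μ ν x x' y y' : S} (h : A.lRPM) (hl : A.Loop μ ν) (hx : A.onUB μ ν x)
    (hx' : A.inU x' ν) (hxx' : A.inU x x') (hy : A.IsPsiM ν x y) (hy' : A.IsPsiM ν x' y') :
    A.inD y y' := by
  have hμx : A.inD μ x := h.inD_of_inU hx.1 hx.2 hl.2
  have hyx : A.inU y x := h.inU_of_inD (hy.2 μ ⟨hμx, hl.2⟩) hy.1.1 hx.1
  exact hy'.2 y ⟨h.inD_of_inU (hyx.trans hxx') hx' hy.1.2, hy.1.2⟩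

theorem IsPsiP.mono {μ ν x x' y y' : S} (h : A.lRPM) (hl : A.Loop μ ν) (hx : A.inD μ x)
    (hx' : A.onDB μ ν x') (hxx' : A.inD x x') (hy : A.IsPsiP μ x y) (hy' : A.IsPsiP μ x' y') :
    A.inU y y' := by
  have hxν : A.inU x' ν := h.inU_of_inD hx'.1 hx'.2 hl.1
  have hxy : A.inD x' y' := h.inD_of_inU hy'.1.1 (hy'.2 ν ⟨hxν, hl.1⟩) hx'.2
  exact hy.2 y' ⟨h.inU_of_inD hx (hxx'.trans hxy) hy'.1.2, hy'.1.2⟩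

end AQSA

/-- The boundary-to-boundary maps `ψ₋` and `ψ₊` are well defined,
fix the endpoints of the loop, and are non-decreasing. -/
theorem psi_monotone {S : Type*} [Fintype S] (A : AQSA S)
    (hrpm : A.lRPM) (μ ν : S) (hl : A.Loop μ ν) :
    (A.IsPsiM ν μ μ ∧ A.IsPsiM ν ν ν ∧ A.IsPsiP μ μ μ ∧ A.IsPsiP μ ν ν) ∧
    (∀ x, A.onUB μ ν x → ∃ y, A.IsPsiM ν x y) ∧
    (∀ x, A.onDB μ ν x → ∃ y, A.IsPsiP μ x y) ∧
    (∀ x x' y y', A.onUB μ ν x → A.onUB μ ν x' → A.inU x x' → x ≠ x' →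
      A.IsPsiM ν x y → A.IsPsiM ν x' y' → A.inD y y') ∧
    (∀ x x' y y', A.onDB μ ν x → A.onDB μ ν x' → A.inD x x' → x ≠ x' →
      A.IsPsiP μ x y → A.IsPsiP μ x' y' → A.inU y y') := by
  refine ⟨⟨?_, ?_, ?_, ?_⟩, ?_, ?_, ?_, ?_⟩
  · exact ⟨⟨.refl μ, hl.2⟩, fun _ hz => hz.1⟩
  · exact ⟨⟨.refl ν, .refl ν⟩, fun _ hz => hz.1⟩
  · exact ⟨⟨.refl μ, .refl μ⟩, fun _ hz => hz.1⟩
  · exact ⟨⟨.refl ν, hl.1⟩, fun _ hz => hz.1⟩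
  · exact fun x hx => AQSA.exists_isPsiM (hrpm.inD_of_inU hx.1 hx.2 hl.2) hl.2
  · exact fun x hx => AQSA.exists_isPsiP (hrpm.inU_of_inD hx.1 hx.2 hl.1) hl.1
  · exact fun x x' y y' hx hx' hxx' _ hy hy' => hy.mono hrpm hl hx hx'.2 hxx' hy'
  · exact fun x x' y y' hx hx' hxx' _ hy hy' => hy.mono hrpm hl hx.1 hx' hxx' hy'
end

section
/- Images of intersection points: in an ℓAQS-A, let κ be an intermediate boundary point of a loop (μ,ν). If κ lies on the U-boundary, then κ is an intersection state (i.e., κ also lies on the D-boundary) if and only if ψ₋(κ) = κ; dually, if κ lies on the D-boundary, then κ is an intersection state if and only if ψ₊(κ) = κ. -/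
/-- Images of intersection points: an intermediate boundary point
`κ` of the loop `(μ,ν)` is an intersection state iff it is a fixed point of
the corresponding boundary map. -/
theorem intersection_point_images {S : Type*} [Fintype S] (A : AQSA S)
    (hrpm : A.lRPM) (μ ν : S) (hl : A.Loop μ ν)
    (κ : S) (hκμ : κ ≠ μ) (hκν : κ ≠ ν) :
    (A.onUB μ ν κ → (A.onDB μ ν κ ↔ A.IsPsiM ν κ κ)) ∧
    (A.onDB μ ν κ → (A.onUB μ ν κ ↔ A.IsPsiP μ κ κ)) := by
  obtain ⟨hU, hD⟩ := hl
  constructor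
  · rintro ⟨⟨i, rfl⟩, k, hk⟩
    have hνU : A.U^[k + i] μ = ν := by rw [Function.iterate_add_apply, hk]
    have hμκ : A.inD μ (A.U^[i] μ) :=
      hrpm.1 μ i (k + i) (Nat.le_add_left i k) (by rwa [hνU])
    exact ⟨fun h => ⟨⟨⟨0, rfl⟩, h.2⟩, fun _ hz => hz.1⟩, fun h => ⟨hμκ, h.1.2⟩⟩
  · rintro ⟨⟨k, hk⟩, j, rfl⟩
    have hμD : A.D^[k + j] ν = μ := by rw [Function.iterate_add_apply, hk]
    have hκν : A.inU (A.D^[j] ν) ν :=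
      hrpm.2 ν j (k + j) (Nat.le_add_left j k) (by rwa [hμD])
    exact ⟨fun h => ⟨⟨⟨0, rfl⟩, h.1⟩, fun _ hz => hz.1⟩, fun h => ⟨h.1.2, hκν⟩⟩
end

section
/- Standard partition and intersection points: in an ℓAQS-A, let (μ,ν) be a loop with μ ≠ ν whose boundary contains an intersection state κ, and let ψ₋⁻¹(μ) = [μ, ν_i]. Then Uν_i ≠ ν; that is, the standard partitioning of the loop must yield three sub loops. -/
theorem apply_iterate_le_of_lt_of_ne {α β : Type*} [Preorder β] {f : α → α} {g : α → β}
    (hg : ∀ x, f x ≠ x → g (f x) < g x) (k : ℕ) (x : α) : g (f^[k] x) ≤ g x := by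
  induction k generalizing x with
  | zero => exact le_rfl
  | succ k ih =>
    rw [Function.iterate_succ_apply]
    by_cases hx : f x = x
    · rw [hx]
      exact ih x
    · exact (ih (f x)).trans (hg x hx).le

theorem eq_of_iterate_eq_of_iterate_eq {α β : Type*} [Preorder β] {f : α → α} {g : α → β}
    (hg : ∀ x, f x ≠ x → g (f x) < g x) {x y : α} {a b : ℕ}
    (hxy : f^[a] x = y) (hyx : f^[b] y = x) : x = y := by
  by_cases hx : f x = x
  · rw [← hxy, Function.iterate_fixed hx]
  cases a with
  | zero => exact hxy
  | succ a =>
    rw [Function.iterate_succ_apply] at hxy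
    have hy : g y ≤ g (f x) := hxy ▸ apply_iterate_le_of_lt_of_ne hg a (f x)
    have hxy' : g x ≤ g y := hyx ▸ apply_iterate_le_of_lt_of_ne hg b y
    exact absurd (hxy'.trans hy) (hg x hx).not_ge

namespace AQSA

variable {S : Type*} {A : AQSA S}

theorem inD_antisymm {x y : S} (hxy : A.inD x y) (hyx : A.inD y x) : x = y := by
  obtain ⟨a, ha⟩ := hxy
  obtain ⟨b, hb⟩ := hyx
  exact eq_of_iterate_eq_of_iterate_eq A.Fm_D hb ha

theorem inU_antisymm {x y : S} (hxy : A.inU x y) (hyx : A.inU y x) : x = y := by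
  obtain ⟨a, ha⟩ := hxy
  obtain ⟨b, hb⟩ := hyx
  exact eq_of_iterate_eq_of_iterate_eq (g := fun σ => OrderDual.toDual (A.Fp σ)) A.Fp_U ha hb

end AQSA

/-- If the boundary of a loop contains an intersection state,
then the standard partitioning yields three sub loops, i.e. `Uν_i ≠ ν`. -/
theorem standard_partition_intersection {S : Type*} [Fintype S] (A : AQSA S)
    (hrpm : A.lRPM) (μ ν : S) (hl : A.Loop μ ν) (hne : μ ≠ ν)
    (n : ℕ) (hn : A.U^[n] μ = ν) (hn' : ∀ k < n, A.U^[k] μ ≠ ν)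
    (κ : S) (hκU : A.onUB μ ν κ) (hκD : A.onDB μ ν κ) (hκμ : κ ≠ μ) (hκν : κ ≠ ν)
    (i : ℕ) (hi : i ≤ n)
    (hpreM : ∀ s ≤ n, (A.IsPsiM ν (A.U^[s] μ) μ ↔ s ≤ i)) :
    A.U (A.U^[i] μ) ≠ ν := by
  obtain ⟨⟨s, hs⟩, hκν'⟩ := hκU
  have hsn : s < n := by
    by_contra! hns
    refine hκν (AQSA.inU_antisymm hκν' ⟨s - n, ?_⟩)
    rw [← hn, ← Function.iterate_add_apply, Nat.sub_add_cancel hns, hs]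
  intro hU
  rw [← Function.iterate_succ_apply' A.U i μ] at hU
  have hni : n ≤ i + 1 := not_lt.mp fun h => hn' _ h hU
  have hψ := (hpreM s hsn.le).mpr (by omega)
  rw [hs] at hψ
  exact hκμ (AQSA.inD_antisymm (hψ.2 κ ⟨⟨0, rfl⟩, hκD.2⟩) hκD.1)
end

section
/- Loop marginality condition: in an ℓAQS-A, let (μ,ν) be a loop with U-boundary states ν_i = Uⁱμ (1 ≤ i ≤ n, where Uⁿμ = ν) and D-boundary states μ_j = D^{m−j}ν (0 ≤ j ≤ m−1, where Dᵐν = μ). For each i let μ⁽ⁱ⁾ be the state on the D-orbit of ν_i with Dμ⁽ⁱ⁾ = μ immediately preceding μ, and for each j let ν⁽ʲ⁾ be the state on the U-orbit of μ_j with Uν⁽ʲ⁾ = ν immediately preceding ν. If F⁻[μ⁽ⁱ⁾] ≥ F⁻[μ⁽ⁿ⁾] for all 1 ≤ i ≤ n and F⁺[ν⁽ʲ⁾] ≤ F⁺[ν⁽⁰⁾] for all 0 ≤ j ≤ m−1, then the loop (μ,ν) is marginal. -/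
namespace AQSA

variable {S L : Type*} [LinearOrder L] {f : S → S} {φ : S → L} {P : S → Prop}

/-- `y` is the first state along `σ, f σ, f² σ, …` satisfying `P`. -/
def IsFirst (f : S → S) (P : S → Prop) (σ y : S) : Prop :=
  ∃ k : ℕ, f^[k] σ = y ∧ P y ∧ ∀ j < k, ¬ P (f^[j] σ)

theorem IsFirst.unique {σ y z : S} (hy : IsFirst f P σ y) (hz : IsFirst f P σ z) : y = z := by
  obtain ⟨k, rfl, hk, hk'⟩ := hy
  obtain ⟨l, rfl, hl, hl'⟩ := hz
  rcases lt_trichotomy k l with h | h | h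
  · exact absurd hk (hl' k h)
  · rw [h]
  · exact absurd hl (hk' l h)

theorem IsFirst.refl {σ : S} (h : P σ) : IsFirst f P σ σ :=
  ⟨0, rfl, h, fun _ hj => absurd hj (Nat.not_lt_zero _)⟩

theorem monotone_iterate_apply (hφ : ∀ σ, f σ ≠ σ → φ σ < φ (f σ)) (σ : S) :
    Monotone fun k : ℕ => φ (f^[k] σ) := by
  refine monotone_nat_of_le_succ fun k => ?_
  rw [Function.iterate_succ_apply']
  by_cases h : f (f^[k] σ) = f^[k] σ
  · rw [h]
  · exact (hφ _ h).le

theorem exists_iterate_fixed [Finite S] (hφ : ∀ σ, f σ ≠ σ → φ σ < φ (f σ)) (σ : S) :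
    ∃ k : ℕ, f (f^[k] σ) = f^[k] σ := by
  by_contra! h
  have hmono : StrictMono fun k : ℕ => φ (f^[k] σ) := strictMono_nat_of_lt_succ fun k => by
    rw [Function.iterate_succ_apply']
    exact hφ _ (h k)
  exact not_injective_infinite_finite (fun k : ℕ => f^[k] σ) fun i j hij =>
    hmono.injective (congrArg φ hij)

/-- The state strictly preceding the first `P`-state of an orbit does not satisfy `P`. -/
theorem IsFirst.not_of_pred (hφ : ∀ σ, f σ ≠ σ → φ σ < φ (f σ)) {σ y x : S}
    (hy : IsFirst f P σ y) (hx : ∃ l : ℕ, f^[l] σ = x) (hxy : f x = y) (hne : x ≠ y) :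
    ¬ P x := by
  intro hPx
  obtain ⟨k, hk, -, hk'⟩ := hy
  obtain ⟨l, rfl⟩ := hx
  have hkl : k ≤ l := not_lt.1 fun h => hk' l h hPx
  have h₁ : φ (f^[k] σ) ≤ φ (f^[l] σ) := monotone_iterate_apply hφ σ hkl
  have h₂ := hφ (f^[l] σ) (by rw [hxy]; exact hne.symm)
  rw [hxy] at h₂
  rw [hk] at h₁
  exact absurd h₁ (not_le.2 h₂)

/-- If `P` is an upper condition on `φ`, the successor `y` of a non-`P` state on the orbit is the
first `P`-state as soon as it satisfies `P`. -/
theorem isFirst_of_pred (hφ : ∀ σ, f σ ≠ σ → φ σ < φ (f σ))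
    (hP : ∀ a b, φ a ≤ φ b → P a → P b) {σ y x : S}
    (hx : ∃ l : ℕ, f^[l] σ = x) (hxy : f x = y) (hPx : ¬ P x) (hPy : P y) :
    IsFirst f P σ y := by
  obtain ⟨l, rfl⟩ := hx
  refine ⟨l + 1, by rw [Function.iterate_succ_apply', hxy], hPy, fun j hj hPj => hPx ?_⟩
  exact hP _ _ (monotone_iterate_apply hφ σ (Nat.lt_succ_iff.1 hj)) hPj

theorem IsFirst.exists_le {σ y : S} (hy : IsFirst f P σ y) {n : ℕ} (hn : P (f^[n] σ)) :
    ∃ k ≤ n, f^[k] σ = y := by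
  obtain ⟨k, hk, -, hk'⟩ := hy
  exact ⟨k, not_lt.1 fun h => hk' n h hn, hk⟩

variable (A : AQSA S)

theorem isFirst_Uact [Finite S] (F : ℝ) (σ : S) :
    IsFirst A.U (fun x => (F : EReal) < A.Fp x) σ (A.Uact F σ) := by
  classical
  have h : ∃ i : ℕ, (F : EReal) < A.Fp (A.U^[i] σ) := by
    obtain ⟨k, hk⟩ := exists_iterate_fixed A.Fp_U σ
    refine ⟨k, ?_⟩
    rw [A.U_fix_unique _ hk, A.Fp_omega]
    exact EReal.coe_lt_top F
  rw [Uact, dif_pos h]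
  exact ⟨_, rfl, Nat.find_spec h, fun j hj => Nat.find_min h hj⟩

theorem toDual_Fm_D (σ : S) (h : A.D σ ≠ σ) :
    OrderDual.toDual (A.Fm σ) < OrderDual.toDual (A.Fm (A.D σ)) :=
  OrderDual.toDual_lt_toDual.2 (A.Fm_D σ h)

theorem isFirst_Dact [Finite S] (F : ℝ) (σ : S) :
    IsFirst A.D (fun x => A.Fm x < (F : EReal)) σ (A.Dact F σ) := by
  classical
  have h : ∃ i : ℕ, A.Fm (A.D^[i] σ) < (F : EReal) := by
    obtain ⟨k, hk⟩ := exists_iterate_fixed A.toDual_Fm_D σ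
    refine ⟨k, ?_⟩
    rw [A.D_fix_unique _ hk, A.Fm_alpha]
    exact EReal.bot_lt_coe F
  rw [Dact, dif_pos h]
  exact ⟨_, rfl, Nat.find_spec h, fun j hj => Nat.find_min h hj⟩

end AQSA

/-- Loop marginality condition. -/
theorem loop_marginality_condition {S : Type*} [Fintype S] (A : AQSA S)
    (hrpm : A.lRPM) (μ ν : S) (hl : A.Loop μ ν)
    (n m : ℕ) (hn : A.U^[n] μ = ν) (hn' : ∀ k < n, A.U^[k] μ ≠ ν)
    (hm : A.D^[m] ν = μ) (hm' : ∀ k < m, A.D^[k] ν ≠ μ)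
    (p q : ℕ → S)
    (hp : ∀ i, 1 ≤ i → i ≤ n →
      A.inD (p i) (A.U^[i] μ) ∧ A.D (p i) = μ ∧ p i ≠ μ)
    (hq : ∀ j, j + 1 ≤ m →
      A.inU (A.D^[m - j] ν) (q j) ∧ A.U (q j) = ν ∧ q j ≠ ν)
    (hFm : ∀ i, 1 ≤ i → i ≤ n → A.Fm (p n) ≤ A.Fm (p i))
    (hFp : ∀ j, j + 1 ≤ m → A.Fp (q j) ≤ A.Fp (q 0)) :
    A.Marginal μ ν := by
  intro Fl Fu ⟨_, hU, hD⟩ F hlF hFu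
  have hνU : AQSA.IsFirst A.U (fun x => (Fu : EReal) < A.Fp x) μ ν := hU ▸ A.isFirst_Uact Fu μ
  have hμD : AQSA.IsFirst A.D (fun x => A.Fm x < (Fl : EReal)) ν μ := hD ▸ A.isFirst_Dact Fl ν
  have hν : (Fu : EReal) < A.Fp ν := by obtain ⟨_, _, h, _⟩ := hνU; exact h
  have hμ : A.Fm μ < (Fl : EReal) := by obtain ⟨_, _, h, _⟩ := hμD; exact h
  constructor
  · obtain ⟨i, hi, hi'⟩ := (A.isFirst_Uact F μ).exists_le (n := n)
      (by rw [hn]; exact (EReal.coe_le_coe_iff.2 hFu).trans_lt hν)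
    rw [← hi']
    refine (A.isFirst_Dact Fl _).unique ?_
    rcases Nat.eq_zero_or_pos i with rfl | hpos
    · exact AQSA.IsFirst.refl hμ
    · obtain ⟨hx, hxμ, -⟩ := hp i hpos hi
      obtain ⟨hy, hyμ, hyne⟩ := hp n (hpos.trans_le hi) le_rfl
      rw [hn] at hy
      have hlast := hμD.not_of_pred A.toDual_Fm_D hy hyμ hyne
      exact AQSA.isFirst_of_pred A.toDual_Fm_D
        (fun _ _ h h' => (OrderDual.toDual_le_toDual.1 h).trans_lt h') hx hxμ
        (fun h => hlast ((hFm i hpos hi).trans_lt h)) hμ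
  · obtain ⟨i, hi, hi'⟩ := (A.isFirst_Dact F ν).exists_le (n := m)
      (by rw [hm]; exact hμ.trans_le (EReal.coe_le_coe_iff.2 hlF))
    rw [← hi']
    refine (A.isFirst_Uact Fu _).unique ?_
    rcases Nat.eq_zero_or_pos i with rfl | hpos
    · exact AQSA.IsFirst.refl hν
    · have hj : m - i + 1 ≤ m := by omega
      obtain ⟨hx, hxν, -⟩ := hq (m - i) hj
      obtain ⟨hy, hyν, hyne⟩ := hq 0 (by omega)
      rw [Nat.sub_sub_self hi] at hx
      rw [Nat.sub_zero, hm] at hy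
      have hlast := hνU.not_of_pred A.Fp_U hy hyν hyne
      exact AQSA.isFirst_of_pred A.Fp_U (fun _ _ h h' => lt_of_lt_of_le h' h) hx hxν
        (fun h => hlast (lt_of_lt_of_le h (hFp (m - i) hj))) hν
end

section
/- ℓAQS-A marginal stability criterion: for an ℓAQS-A the following are equivalent: (a) the automaton exhibits marginal stability (every loop is marginal); (b) for every loop (μ,ν), with predecessor states μ⁽ⁱ⁾ (Dμ⁽ⁱ⁾ = μ, μ⁽ⁱ⁾ on the D-orbit of the U-boundary state ν_i = Uⁱμ, 1 ≤ i ≤ n) and ν⁽ʲ⁾ (Uν⁽ʲ⁾ = ν, ν⁽ʲ⁾ on the U-orbit of the D-boundary state μ_j = D^{m−j}ν, 0 ≤ j ≤ m−1), the sequence (F⁻[μ⁽ⁱ⁾])_{1 ≤ i ≤ n} is non-increasing in i and the sequence (F⁺[ν⁽ʲ⁾])_{0 ≤ j ≤ m−1} is non-increasing in j. -/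
namespace AQSA

variable {S : Type*} (A : AQSA S)

/-- The automaton obtained by reversing the sign of the field, which exchanges `U` and `D`. -/
noncomputable def dual : AQSA S where
  Fm σ := -A.Fp σ
  Fp σ := -A.Fm σ
  U := A.D
  D := A.U
  ω := A.α
  α := A.ω
  lt_trap σ := EReal.neg_lt_neg_iff.2 (A.lt_trap σ)
  Fp_U σ h := EReal.neg_lt_neg_iff.2 (A.Fm_D σ h)
  Fm_U σ := EReal.neg_lt_neg_iff.2 (A.Fp_D σ)
  Fm_D σ h := EReal.neg_lt_neg_iff.2 (A.Fp_U σ h)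
  Fp_D σ := EReal.neg_lt_neg_iff.2 (A.Fm_U σ)
  U_fix := A.D_fix
  U_fix_unique := A.D_fix_unique
  D_fix := A.U_fix
  D_fix_unique := A.U_fix_unique
  Fp_omega := by simp [A.Fm_alpha]
  Fm_alpha := by simp [A.Fp_omega]

theorem dual_dual : A.dual.dual = A := by
  simp [dual]

variable {A}

theorem dual_Dact (F : ℝ) (σ : S) : A.dual.Dact F σ = A.Uact (-F) σ := by
  have h : ∀ i : ℕ, A.dual.Fm (A.dual.D^[i] σ) < (F : EReal) ↔
      ((-F : ℝ) : EReal) < A.Fp (A.U^[i] σ) := fun i => by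
    rw [EReal.coe_neg]
    exact EReal.neg_lt_comm
  by_cases hex : ∃ i : ℕ, ((-F : ℝ) : EReal) < A.Fp (A.U^[i] σ)
  · rw [Dact, Uact, dif_pos hex, dif_pos ((exists_congr h).2 hex), Nat.find_congr' (h _)]
    rfl
  · rw [Dact, Uact, dif_neg hex, dif_neg (mt (exists_congr h).1 hex)]

theorem dual_Uact (F : ℝ) (σ : S) : A.dual.Uact F σ = A.Dact (-F) σ := by
  have h : ∀ i : ℕ, (F : EReal) < A.dual.Fp (A.dual.U^[i] σ) ↔
      A.Fm (A.D^[i] σ) < ((-F : ℝ) : EReal) := fun i => by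
    rw [EReal.coe_neg]
    exact EReal.lt_neg_comm
  by_cases hex : ∃ i : ℕ, A.Fm (A.D^[i] σ) < ((-F : ℝ) : EReal)
  · rw [Dact, Uact, dif_pos hex, dif_pos ((exists_congr h).2 hex), Nat.find_congr' (h _)]
    rfl
  · rw [Dact, Uact, dif_neg hex, dif_neg (mt (exists_congr h).1 hex)]

theorem Loop.dual {μ ν : S} (h : A.Loop μ ν) : A.dual.Loop ν μ := ⟨h.2, h.1⟩

theorem lRPM.dual (h : A.lRPM) : A.dual.lRPM := ⟨h.2, h.1⟩

theorem Traversing.dual {μ ν : S} {Fl Fu : ℝ} (h : A.Traversing μ ν Fl Fu) :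
    A.dual.Traversing ν μ (-Fu) (-Fl) :=
  ⟨neg_lt_neg h.1, by rw [dual_Uact, neg_neg]; exact h.2.2,
    by rw [dual_Dact, neg_neg]; exact h.2.1⟩

theorem MarginalStability.dual (h : A.MarginalStability) : A.dual.MarginalStability := by
  intro μ ν hl Fl Fu ht F h₁ h₂
  have := h ν μ hl.dual (-Fu) (-Fl) (A.dual_dual ▸ ht.dual) (-F) (neg_le_neg h₂) (neg_le_neg h₁)
  simp only [dual_Uact, dual_Dact]
  exact ⟨this.2, this.1⟩

theorem Fp_le_iterate_U (k : ℕ) (σ : S) : A.Fp σ ≤ A.Fp (A.U^[k] σ) := by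
  induction k with
  | zero => exact le_rfl
  | succ k ih =>
    rw [Function.iterate_succ_apply']
    by_cases h : A.U (A.U^[k] σ) = A.U^[k] σ
    · rwa [h]
    · exact ih.trans (A.Fp_U _ h).le

theorem Fm_iterate_D_le (k : ℕ) (σ : S) : A.Fm (A.D^[k] σ) ≤ A.Fm σ :=
  EReal.neg_le_neg_iff.1 (A.dual.Fp_le_iterate_U k σ)

theorem iterate_U_ne_self {μ : S} (h : A.U μ ≠ μ) {i : ℕ} (hi : 1 ≤ i) : A.U^[i] μ ≠ μ := by
  obtain ⟨k, rfl⟩ := Nat.exists_eq_add_of_le' hi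
  intro he
  have h₁ := A.Fp_le_iterate_U k (A.U μ)
  rw [← Function.iterate_succ_apply, he] at h₁
  exact (A.Fp_U μ h).not_ge h₁

theorem exists_iterate_Fm_lt [Finite S] (F : ℝ) (σ : S) :
    ∃ i : ℕ, A.Fm (A.D^[i] σ) < (F : EReal) := by
  obtain ⟨i, j, hij, he⟩ : ∃ i j : ℕ, i < j ∧ A.D^[i] σ = A.D^[j] σ := by
    obtain ⟨i, j, hne, he⟩ := Finite.exists_ne_map_eq_of_infinite fun i : ℕ => A.D^[i] σ
    rcases hne.lt_or_gt with h | h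
    exacts [⟨i, j, h, he⟩, ⟨j, i, h, he.symm⟩]
  have hfix : A.D (A.D^[i] σ) = A.D^[i] σ := by
    by_contra h
    refine iterate_U_ne_self (A := A.dual) h (i := j - i) (by omega) ?_
    change A.D^[j - i] (A.D^[i] σ) = _
    rw [← Function.iterate_add_apply, Nat.sub_add_cancel hij.le, he]
  exact ⟨i, by rw [A.D_fix_unique _ hfix, A.Fm_alpha]; exact EReal.bot_lt_coe F⟩

theorem Dact_spec [Finite S] (F : ℝ) (σ : S) :
    ∃ k : ℕ, A.Dact F σ = A.D^[k] σ ∧ A.Fm (A.D^[k] σ) < F ∧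
      ∀ i < k, (F : EReal) ≤ A.Fm (A.D^[i] σ) := by
  classical
  have h := A.exists_iterate_Fm_lt F σ
  refine ⟨Nat.find h, ?_, Nat.find_spec h, fun i hi => not_lt.1 (Nat.find_min h hi)⟩
  rw [Dact, dif_pos h]

theorem Uact_spec [Finite S] (F : ℝ) (σ : S) :
    ∃ k : ℕ, A.Uact F σ = A.U^[k] σ ∧ (F : EReal) < A.Fp (A.U^[k] σ) ∧
      ∀ i < k, A.Fp (A.U^[i] σ) ≤ F := by
  obtain ⟨k, h₁, h₂, h₃⟩ := A.dual.Dact_spec (-F) σ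
  rw [dual_Dact, neg_neg] at h₁
  rw [EReal.coe_neg] at h₂ h₃
  exact ⟨k, h₁, EReal.neg_lt_neg_iff.1 h₂, fun i hi => EReal.neg_le_neg_iff.1 (h₃ i hi)⟩

theorem Dact_eq_self [Finite S] {F : ℝ} {σ : S} (h : A.Fm σ < F) : A.Dact F σ = σ := by
  obtain ⟨k, h₁, -, h₃⟩ := A.Dact_spec F σ
  rcases Nat.eq_zero_or_pos k with rfl | hk
  · exact h₁
  · exact absurd h (h₃ 0 hk).not_gt

theorem Dact_eq_iff [Finite S] {F : ℝ} {x p μ : S} (hp : A.inD p x) (hD : A.D p = μ)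
    (hne : p ≠ μ) : A.Dact F x = μ ↔ A.Fm μ < F ∧ (F : EReal) ≤ A.Fm p := by
  obtain ⟨j, hj⟩ := hp
  obtain ⟨k, h₁, h₂, h₃⟩ := A.Dact_spec F x
  have hlt : A.Fm μ < A.Fm p := by
    have := A.Fm_D p (by rw [hD]; exact hne.symm)
    rwa [hD] at this
  have hμ : A.D^[j + 1] x = μ := by rw [Function.iterate_succ_apply', hj, hD]
  rw [h₁]
  constructor
  · intro he
    rw [he] at h₂
    refine ⟨h₂, ?_⟩
    rcases lt_or_ge j k with hjk | hjk
    · exact hj ▸ h₃ j hjk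
    · have := A.Fm_iterate_D_le (j - k) (A.D^[k] x)
      rw [← Function.iterate_add_apply, Nat.sub_add_cancel hjk, hj, he] at this
      exact absurd hlt this.not_gt
  · rintro ⟨hF, hFp⟩
    have hk : k ≤ j + 1 := by
      by_contra! h
      exact absurd (hμ ▸ hF) (h₃ _ h).not_gt
    have hk' : j < k := by
      by_contra! h
      have := A.Fm_iterate_D_le (j - k) (A.D^[k] x)
      rw [← Function.iterate_add_apply, Nat.sub_add_cancel h, hj] at this
      exact absurd (h₂.trans_le hFp) this.not_gt
    rw [show k = j + 1 by omega, hμ]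

theorem Uact_eq_iff [Finite S] {F : ℝ} {x p ν : S} (hp : A.inU x p) (hU : A.U p = ν)
    (hne : p ≠ ν) : A.Uact F x = ν ↔ (F : EReal) < A.Fp ν ∧ A.Fp p ≤ F := by
  have h := Dact_eq_iff (A := A.dual) (F := -F) hp hU hne
  rw [dual_Dact, neg_neg, EReal.coe_neg] at h
  exact h.trans (and_congr EReal.neg_lt_neg_iff EReal.neg_le_neg_iff)

theorem exists_predecessor {x μ : S} (h : A.inD μ x) (hne : x ≠ μ) :
    ∃ p, A.inD p x ∧ A.D p = μ ∧ p ≠ μ := by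
  classical
  rcases hk : Nat.find h with _ | k
  · have := Nat.find_spec h
    rw [hk] at this
    exact absurd this hne
  · have := Nat.find_spec h
    rw [hk, Function.iterate_succ_apply'] at this
    exact ⟨_, ⟨k, rfl⟩, this, Nat.find_min h (by omega)⟩

theorem exists_predecessors (hrpm : A.lRPM) {μ : S} {n : ℕ} (hl : A.inD μ (A.U^[n] μ))
    (hn : ∀ k < n, A.U^[k] μ ≠ A.U^[n] μ) :
    ∃ p : ℕ → S, ∀ i, 1 ≤ i → i ≤ n → A.inD (p i) (A.U^[i] μ) ∧ A.D (p i) = μ ∧ p i ≠ μ := by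
  have h : ∀ i, ∃ p, 1 ≤ i → i ≤ n → A.inD p (A.U^[i] μ) ∧ A.D p = μ ∧ p ≠ μ := by
    intro i
    by_cases hi : 1 ≤ i ∧ i ≤ n
    · have hU : A.U μ ≠ μ := fun hfix => hn 0 (by omega) (Function.iterate_fixed hfix n).symm
      obtain ⟨p, hp⟩ := exists_predecessor (hrpm.1 μ i n hi.2 hl) (iterate_U_ne_self hU hi.1)
      exact ⟨p, fun _ _ => hp⟩
    · exact ⟨μ, fun h₁ h₂ => absurd ⟨h₁, h₂⟩ hi⟩
  choose p hp using h
  exact ⟨p, hp⟩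

theorem Dact_Uact_eq_of_Fm_le [Finite S] {μ ν : S} {n : ℕ} (hn : A.U^[n] μ = ν) {p : ℕ → S}
    (hp : ∀ i, 1 ≤ i → i ≤ n → A.inD (p i) (A.U^[i] μ) ∧ A.D (p i) = μ ∧ p i ≠ μ)
    (hmono : ∀ i, 1 ≤ i → i ≤ n → A.Fm (p n) ≤ A.Fm (p i))
    {Fl Fu F : ℝ} (ht : A.Traversing μ ν Fl Fu) (hF : F ≤ Fu) :
    A.Dact Fl (A.Uact F μ) = μ := by
  obtain ⟨-, hU, hD⟩ := ht
  have hμ : A.Fm μ < Fl := by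
    obtain ⟨k, h₁, h₂, -⟩ := A.Dact_spec Fl ν
    rwa [← h₁, hD] at h₂
  have hν : (Fu : EReal) < A.Fp ν := by
    obtain ⟨k, h₁, h₂, -⟩ := A.Uact_spec Fu μ
    rwa [← h₁, hU] at h₂
  obtain ⟨i, h₁, h₂, h₃⟩ := A.Uact_spec F μ
  have hi : i ≤ n := by
    by_contra! h
    have := h₃ n h
    rw [hn] at this
    exact absurd ((EReal.coe_le_coe_iff.2 hF).trans_lt hν) this.not_gt
  rw [h₁]
  rcases Nat.eq_zero_or_pos i with rfl | hi₀
  · exact Dact_eq_self hμ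
  · obtain ⟨a, b, c⟩ := hp i hi₀ hi
    obtain ⟨a', b', c'⟩ := hp n (hi₀.trans_le hi) le_rfl
    rw [hn] at a'
    exact (Dact_eq_iff a b c).2
      ⟨hμ, ((Dact_eq_iff a' b' c').1 hD).2.trans (hmono i hi₀ hi)⟩

theorem MarginalStability.Fm_predecessor_le [Finite S] (hs : A.MarginalStability)
    (hrpm : A.lRPM) {μ : S} {n : ℕ} (hl : A.inD μ (A.U^[n] μ))
    (hn : ∀ k < n, A.U^[k] μ ≠ A.U^[n] μ) {p : ℕ → S}
    (hp : ∀ i, 1 ≤ i → i ≤ n → A.inD (p i) (A.U^[i] μ) ∧ A.D (p i) = μ ∧ p i ≠ μ)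
    {i i' : ℕ} (hi : 1 ≤ i) (hii' : i ≤ i') (hi' : i' ≤ n) : A.Fm (p i') ≤ A.Fm (p i) := by
  have hstep : ∀ k < n, A.U (A.U^[k] μ) ≠ A.U^[k] μ := by
    intro k hk hfix
    apply hn k hk
    have := Function.iterate_fixed hfix (n - k)
    rwa [← Function.iterate_add_apply, Nat.sub_add_cancel hk.le, eq_comm] at this
  have hreal : ∀ k < n, ∃ r : ℝ, (r : EReal) = A.Fp (A.U^[k] μ) := fun k hk =>
    ⟨_, EReal.coe_toReal (A.Fp_U _ (hstep k hk)).ne_top (A.lt_trap _).ne_bot⟩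
  obtain ⟨k, rfl⟩ := Nat.exists_eq_add_of_le' hi
  obtain ⟨k', rfl⟩ := Nat.exists_eq_add_of_le' (hi.trans hii')
  obtain ⟨a, b, c⟩ := hp _ hi (hii'.trans hi')
  obtain ⟨a', b', c'⟩ := hp _ (hi.trans hii') hi'
  obtain ⟨F, hF⟩ := hreal k (by omega)
  obtain ⟨Fu, hFu⟩ := hreal k' (by omega)
  have hμ : A.Fm μ < A.Fm (p (k' + 1)) := by
    have := A.Fm_D (p (k' + 1)) (by rw [b']; exact c'.symm)
    rwa [b'] at this
  obtain ⟨Fl, hFl⟩ : ∃ r : ℝ, (r : EReal) = A.Fm (p (k' + 1)) :=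
    ⟨_, EReal.coe_toReal (A.lt_trap _).ne_top hμ.ne_bot⟩
  have hlow : ∀ j, A.Fm (p (k' + 1)) < A.Fp (A.U^[j] μ) := fun j => by
    have := A.Fp_D (p (k' + 1))
    rw [b'] at this
    exact this.trans_le (A.Fp_le_iterate_U j μ)
  have hUact : ∀ j < n, ∀ r : ℝ, (r : EReal) = A.Fp (A.U^[j] μ) →
      A.Uact r μ = A.U^[j + 1] μ := by
    intro j hj r hr
    have hU := Function.iterate_succ_apply' A.U j μ
    refine (Uact_eq_iff ⟨j, rfl⟩ hU.symm (by rw [hU]; exact (hstep j hj).symm)).2 ⟨?_, hr.ge⟩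
    rw [hr, hU]
    exact A.Fp_U _ (hstep j hj)
  have ht : A.Traversing μ (A.U^[k' + 1] μ) Fl Fu := by
    refine ⟨?_, hUact k' (by omega) Fu hFu, ?_⟩
    · rw [← EReal.coe_lt_coe_iff, hFl, hFu]
      exact hlow k'
    · exact (Dact_eq_iff a' b' c').2 ⟨hFl ▸ hμ, hFl.le⟩
  have hmarg := (hs μ (A.U^[k' + 1] μ) ⟨⟨_, rfl⟩, hrpm.1 μ _ n hi' hl⟩ Fl Fu ht F
    (by rw [← EReal.coe_le_coe_iff, hFl, hF]; exact (hlow k).le)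
    (by
      rw [← EReal.coe_le_coe_iff, hF, hFu, ← Nat.sub_add_cancel (show k ≤ k' by omega),
        Function.iterate_add_apply]
      exact A.Fp_le_iterate_U _ _)).1
  rw [hUact k (by omega) F hF] at hmarg
  rw [← hFl]
  exact ((Dact_eq_iff a b c).1 hmarg).2

end AQSA

/-- ℓAQS-A marginal stability criterion: marginal stability is
equivalent to the monotonicity of the trapping fields of the predecessor
states of every loop. -/
theorem marginal_stability_criterion {S : Type*} [Fintype S] (A : AQSA S)
    (hrpm : A.lRPM) :
    A.MarginalStability ↔
      (∀ μ ν : S, A.Loop μ ν →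
        ∀ n m : ℕ, A.U^[n] μ = ν → (∀ k < n, A.U^[k] μ ≠ ν) →
          A.D^[m] ν = μ → (∀ k < m, A.D^[k] ν ≠ μ) →
        ∀ p q : ℕ → S,
          (∀ i, 1 ≤ i → i ≤ n →
            A.inD (p i) (A.U^[i] μ) ∧ A.D (p i) = μ ∧ p i ≠ μ) →
          (∀ j, j + 1 ≤ m →
            A.inU (A.D^[m - j] ν) (q j) ∧ A.U (q j) = ν ∧ q j ≠ ν) →
          (∀ i i', 1 ≤ i → i ≤ i' → i' ≤ n → A.Fm (p i') ≤ A.Fm (p i)) ∧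
          (∀ j j', j ≤ j' → j' + 1 ≤ m → A.Fp (q j') ≤ A.Fp (q j))) := by
  constructor
  · intro hs μ ν hl n m hn hn' hm hm' p q hp hq
    refine ⟨fun i i' h₁ h₂ h₃ => ?_, fun j j' h₁ h₂ => ?_⟩
    · subst hn
      exact hs.Fm_predecessor_le hrpm hl.2 hn' hp h₁ h₂ h₃
    · subst hm
      have h := hs.dual.Fm_predecessor_le (p := fun k => q (m - k)) hrpm.dual hl.1 hm'
        (fun k hk hkm => by
          have := hq (m - k) (by omega)
          rwa [Nat.sub_sub_self hkm] at this)
        (i := m - j') (i' := m - j) (by omega) (by omega) (by omega)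
      simp only [Nat.sub_sub_self (show j ≤ m by omega),
        Nat.sub_sub_self (show j' ≤ m by omega)] at h
      exact EReal.neg_le_neg_iff.1 h
  · classical
    intro h μ ν hl Fl Fu ht F h₁ h₂
    obtain ⟨n, hn, hn'⟩ : ∃ n, A.U^[n] μ = ν ∧ ∀ k < n, A.U^[k] μ ≠ ν :=
      ⟨_, Nat.find_spec hl.1, fun _ => Nat.find_min hl.1⟩
    obtain ⟨m, hm, hm'⟩ : ∃ m, A.D^[m] ν = μ ∧ ∀ k < m, A.D^[k] ν ≠ μ :=
      ⟨_, Nat.find_spec hl.2, fun _ => Nat.find_min hl.2⟩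
    obtain ⟨p, hp⟩ := AQSA.exists_predecessors hrpm (hn.symm ▸ hl.2) (hn.symm ▸ hn')
    obtain ⟨q, hq⟩ := AQSA.exists_predecessors (A := A.dual) (μ := ν) (n := m) hrpm.dual
      (by
        change A.inU (A.D^[m] ν) ν
        exact hm.symm ▸ hl.1)
      (by
        change ∀ k < m, A.D^[k] ν ≠ A.D^[m] ν
        exact hm.symm ▸ hm')
    obtain ⟨hb₁, hb₂⟩ := h μ ν hl n m hn hn' hm hm' p (fun j => q (m - j)) hp
      (fun j hj => hq (m - j) (by omega) (by omega))
    refine ⟨AQSA.Dact_Uact_eq_of_Fm_le hn hp (fun i hi hin => hb₁ i n hi hin le_rfl) ht h₂, ?_⟩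
    have := AQSA.Dact_Uact_eq_of_Fm_le (A := A.dual) (F := -F) hm hq
      (fun i hi him => EReal.neg_le_neg_iff.2 (by
        have := hb₂ 0 (m - i) (Nat.zero_le _) (by omega)
        rwa [Nat.sub_sub_self him, Nat.sub_zero] at this)) ht.dual (neg_le_neg h₁)
    rwa [AQSA.dual_Uact, AQSA.dual_Dact, neg_neg, neg_neg] at this
end
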